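/- arXiv:1906.06261 — 4 statements merged into one kernel-verified Lean document; each statement's English description precedes it below -/
import Mathlib

section
/- Let A be a real Banach algebra with unit e and let P ⊆ A be a solid cone. If k ∈ P and the spectral radius ρ(k) < 1, then the sequence of powers (k^n)_{n∈ℕ} is a c-sequence, i.e. for every c ∈ A with θ ≪ c there exists N such that k^n ≪ c for all n ≥ N. -/
open Filter Topology

/-- Spectral radius via the Gelfand formula: `inf_{n ≥ 1} ‖k ^ n‖ ^ (1 / n)`. -/
noncomputable def specRad {A : Type*} [NormedRing A] (k : A) : ℝ :=
  ⨅ n : ℕ, ‖k ^ (n + 1)‖ ^ ((1 : ℝ) / (n + 1))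

/-- A cone in a real Banach algebra `A`: a nonempty closed subset containing `0` and `1`,
closed under nonnegative real combinations and multiplication, with `P ∩ (-P) = {0}`. -/
structure IsCone {A : Type*} [NormedRing A] [NormedAlgebra ℝ A] (P : Set A) : Prop where
  closed : IsClosed P
  zero_mem : (0 : A) ∈ P
  one_mem : (1 : A) ∈ P
  smul_mem : ∀ a : ℝ, 0 ≤ a → ∀ x ∈ P, a • x ∈ P
  add_mem : ∀ x ∈ P, ∀ y ∈ P, x + y ∈ P
  mul_mem : ∀ x ∈ P, ∀ y ∈ P, x * y ∈ P
  antisymm : ∀ x ∈ P, -x ∈ P → x = 0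

/-- A c-sequence with respect to the solid cone `P`: for every `c ≫ 0` eventually `u n ≪ c`. -/
def CSeq {A : Type*} [NormedRing A] [NormedAlgebra ℝ A] (P : Set A) (u : ℕ → A) : Prop :=
  ∀ c : A, c ∈ interior P → ∃ N : ℕ, ∀ n ≥ N, c - u n ∈ interior P

/-- A cone metric on `X` over the Banach algebra `A` with cone `P`. -/
structure IsConeMetric {A : Type*} [NormedRing A] [NormedAlgebra ℝ A] (P : Set A)
    {X : Type*} (d : X → X → A) : Prop where
  mem_cone : ∀ x y, d x y ∈ P
  eq_zero_iff : ∀ x y, d x y = 0 ↔ x = y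
  symm : ∀ x y, d x y = d y x
  triangle : ∀ x y z, d x y + d y z - d x z ∈ P

/-- Completeness of a cone metric space over a Banach algebra:
every Cauchy sequence converges (in the c-sequence sense). -/
def ConeComplete {A : Type*} [NormedRing A] [NormedAlgebra ℝ A] (P : Set A)
    {X : Type*} (d : X → X → A) : Prop :=
  ∀ u : ℕ → X,
    (∀ c : A, c ∈ interior P → ∃ N : ℕ, ∀ m ≥ N, ∀ n ≥ N, c - d (u m) (u n) ∈ interior P) →
    ∃ x : X, CSeq P fun n => d (u n) x

/-- `Tinf` is a (G)-limit of the family `T` (property (G)). -/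
def GLimit {A : Type*} [NormedRing A] [NormedAlgebra ℝ A] (P : Set A)
    {X : Type*} (d : X → X → A) (Xn : ℕ → Set X) (Xinf : Set X)
    (T : ℕ → X → X) (Tinf : X → X) : Prop :=
  ∀ x ∈ Xinf, ∃ u : ℕ → X, (∀ n, u n ∈ Xn n) ∧
    CSeq P (fun n => d (u n) x) ∧ CSeq P (fun n => d (T n (u n)) (Tinf x))

/-- `Tinf` is an (H)-limit of the family `T` (property (H)). -/
def HLimit {A : Type*} [NormedRing A] [NormedAlgebra ℝ A] (P : Set A)
    {X : Type*} (d : X → X → A) (Xn : ℕ → Set X) (Xinf : Set X)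
    (T : ℕ → X → X) (Tinf : X → X) : Prop :=
  ∀ u : ℕ → X, (∀ n, u n ∈ Xn n) → ∃ v : ℕ → X, (∀ n, v n ∈ Xinf) ∧
    CSeq P (fun n => d (u n) (v n)) ∧ CSeq P (fun n => d (T n (u n)) (Tinf (v n)))

/-- In a seminormed ring, the powers of `k` tend to zero as soon as some positive power of `k`
has norm less than one. -/
theorem tendsto_pow_zero_of_norm_pow_lt_one {A : Type*} [SeminormedRing A] {k : A} {m : ℕ}
    (hm : 0 < m) (hk : ‖k ^ m‖ < 1) : Tendsto (fun n => k ^ n) atTop (𝓝 0) := by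
  have hq : Tendsto (fun n : ℕ => ‖(k ^ m) ^ (n / m)‖ * ∑ r ∈ Finset.range m, ‖k ^ r‖)
      atTop (𝓝 0) := by
    simpa using (((tendsto_pow_atTop_nhds_zero_of_norm_lt_one hk).comp
      (Nat.tendsto_div_const_atTop hm.ne')).norm).mul_const (∑ r ∈ Finset.range m, ‖k ^ r‖)
  refine squeeze_zero_norm (fun n => ?_) hq
  calc ‖k ^ n‖ = ‖(k ^ m) ^ (n / m) * k ^ (n % m)‖ := by
        rw [← pow_mul, ← pow_add, Nat.div_add_mod]
    _ ≤ ‖(k ^ m) ^ (n / m)‖ * ‖k ^ (n % m)‖ := norm_mul_le _ _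
    _ ≤ _ := by
        gcongr
        exact Finset.single_le_sum (f := fun r => ‖k ^ r‖) (fun _ _ => norm_nonneg _)
          (Finset.mem_range.2 (Nat.mod_lt n hm))

/-- If the spectral radius is less than one, some positive power has norm less than one. -/
theorem exists_norm_pow_lt_one_of_specRad_lt_one {A : Type*} [NormedRing A] {k : A}
    (h : specRad k < 1) : ∃ m : ℕ, 0 < m ∧ ‖k ^ m‖ < 1 := by
  obtain ⟨n, hn⟩ := exists_lt_of_ciInf_lt h
  refine ⟨n + 1, n.succ_pos, ?_⟩
  by_contra! hge
  exact hn.not_ge (Real.one_le_rpow hge (by positivity))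

/-- A sequence converging to zero in norm is a c-sequence. -/
theorem CSeq.of_tendsto_zero {A : Type*} [NormedRing A] [NormedAlgebra ℝ A] (P : Set A)
    {u : ℕ → A} (hu : Tendsto u atTop (𝓝 0)) : CSeq P u := by
  intro c hc
  have hlim : Tendsto (fun n => c - u n) atTop (𝓝 c) := by
    simpa using hu.const_sub c
  exact eventually_atTop.1 (hlim.eventually (isOpen_interior.mem_nhds hc))

/-- If `k` belongs to a solid cone `P` of a real Banach algebra and its spectral radius is
less than `1`, then the sequence of powers `(k ^ n)` is a c-sequence. -/
theorem powers_cSeq_of_specRad_lt_one {A : Type*} [NormedRing A] [NormedAlgebra ℝ A]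
    [CompleteSpace A] (P : Set A) (hP : IsCone P) (hsolid : (interior P).Nonempty)
    (k : A) (hk : k ∈ P) (hρ : specRad k < 1) :
    CSeq P fun n => k ^ n := by
  obtain ⟨m, hm, hkm⟩ := exists_norm_pow_lt_one_of_specRad_lt_one hρ
  exact CSeq.of_tendsto_zero P (tendsto_pow_zero_of_norm_pow_lt_one hm hkm)
end

section
/- Let (X,d) be a cone metric space over a Banach algebra A with solid cone P, let X_n (n ∈ ℕ) and X_∞ be nonempty subsets of X, and let T_n : X_n → X and T_∞ : X_∞ → X be maps. Assume: (i) for every x ∈ X_∞ there exists a sequence (x_n) with x_n ∈ X_n such that (d(x_n,x)) is a c-sequence; (ii) T_∞ is sequentially continuous, i.e. whenever (y_n) ⊆ X_∞ and (d(y_n,x)) is a c-sequence for some x ∈ X_∞, then (d(T_∞ y_n, T_∞ x)) is a c-sequence; (iii) T_∞ is an (H)-limit of the family (T_n). Then T_∞ is a (G)-limit of (T_n). -/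
open Filter Topology

theorem IsCone.add_mem_interior {A : Type*} [NormedRing A] [NormedAlgebra ℝ A] {P : Set A}
    (hP : IsCone P) {a b : A} (ha : a ∈ interior P) (hb : b ∈ P) : a + b ∈ interior P := by
  have hsub : (fun x => x + b) '' interior P ⊆ interior P := by
    refine interior_maximal ?_ (isOpenMap_add_right b _ isOpen_interior)
    rintro _ ⟨x, hx, rfl⟩
    exact hP.add_mem x (interior_subset hx) b hb
  exact hsub ⟨a, ha, rfl⟩

theorem IsCone.smul_mem_interior {A : Type*} [NormedRing A] [NormedAlgebra ℝ A] {P : Set A}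
    (hP : IsCone P) {r : ℝ} (hr : 0 < r) {a : A} (ha : a ∈ interior P) :
    r • a ∈ interior P := by
  have hsub : (fun x => r • x) '' interior P ⊆ interior P := by
    refine interior_maximal ?_ (isOpenMap_smul₀ hr.ne' _ isOpen_interior)
    rintro _ ⟨x, hx, rfl⟩
    exact hP.smul_mem r hr.le x (interior_subset hx)
  exact hsub ⟨a, ha, rfl⟩

theorem CSeq.add {A : Type*} [NormedRing A] [NormedAlgebra ℝ A] {P : Set A}
    (hP : IsCone P) {u v : ℕ → A} (hu : CSeq P u) (hv : CSeq P v) :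
    CSeq P fun n => u n + v n := by
  intro c hc
  have hc' := hP.smul_mem_interior (r := 1 / 2) (by norm_num) hc
  obtain ⟨M, hM⟩ := hu _ hc'
  obtain ⟨N, hN⟩ := hv _ hc'
  refine ⟨max M N, fun n hn => ?_⟩
  have h := hP.add_mem_interior (hM n (le_of_max_le_left hn))
    (interior_subset (hN n (le_of_max_le_right hn)))
  convert h using 1
  module

theorem CSeq.of_sub_mem {A : Type*} [NormedRing A] [NormedAlgebra ℝ A] {P : Set A}
    (hP : IsCone P) {u v : ℕ → A} (hv : CSeq P v) (huv : ∀ n, v n - u n ∈ P) :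
    CSeq P u := by
  intro c hc
  obtain ⟨N, hN⟩ := hv c hc
  refine ⟨N, fun n hn => ?_⟩
  simpa using hP.add_mem_interior (hN n hn) (huv n)

theorem IsConeMetric.cSeq_trans {A : Type*} [NormedRing A] [NormedAlgebra ℝ A] {P : Set A}
    (hP : IsCone P) {X : Type*} {d : X → X → A} (hd : IsConeMetric P d) {x y z : ℕ → X}
    (hxy : CSeq P fun n => d (x n) (y n)) (hyz : CSeq P fun n => d (y n) (z n)) :
    CSeq P fun n => d (x n) (z n) :=
  (hxy.add hP hyz).of_sub_mem hP fun n => hd.triangle (x n) (y n) (z n)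

/-- If every point of `X∞` can be approximated by points of the `X n`, `T∞` is sequentially
continuous, and `T∞` is an (H)-limit of `(T n)`, then `T∞` is a (G)-limit of `(T n)`. -/
theorem gLimit_of_hLimit {A : Type*} [NormedRing A] [NormedAlgebra ℝ A] [CompleteSpace A]
    {X : Type*} (P : Set A) (hP : IsCone P) (hsolid : (interior P).Nonempty)
    (d : X → X → A) (hd : IsConeMetric P d)
    (Xn : ℕ → Set X) (hXn : ∀ n, (Xn n).Nonempty) (Xinf : Set X) (hXinf : Xinf.Nonempty)
    (T : ℕ → X → X) (Tinf : X → X)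
    (happrox : ∀ x ∈ Xinf, ∃ u : ℕ → X, (∀ n, u n ∈ Xn n) ∧ CSeq P fun n => d (u n) x)
    (hseqcont : ∀ y : ℕ → X, (∀ n, y n ∈ Xinf) → ∀ x ∈ Xinf,
      CSeq P (fun n => d (y n) x) → CSeq P fun n => d (Tinf (y n)) (Tinf x))
    (hH : HLimit P d Xn Xinf T Tinf) :
    GLimit P d Xn Xinf T Tinf := by
  intro x hx
  obtain ⟨u, hu, hux⟩ := happrox x hx
  obtain ⟨v, hv, huv, hTuv⟩ := hH u hu
  have hvu : CSeq P fun n => d (v n) (u n) := by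
    simpa only [fun n => hd.symm (v n) (u n)] using huv
  have hvx : CSeq P fun n => d (v n) x := hd.cSeq_trans hP hvu hux
  exact ⟨u, hu, hux, hd.cSeq_trans hP hTuv (hseqcont v hv x hx hvx)⟩
end

section
/- Let (X,d) be a cone metric space over a Banach algebra A with solid cone P, let X_n (n ∈ ℕ) and X_∞ be nonempty subsets of X, and let T_n : X_n → X be maps. Assume each T_n is k-Lipschitz w.r.t. the cone metric for a common k ∈ P, i.e. d(T_n x, T_n y) ⪯ k·d(x,y) for all x, y ∈ X_n. If T_∞ : X_∞ → X and T_∞' : X_∞ → X are both (G)-limits of the family (T_n), then T_∞ = T_∞', i.e. the (G)-limit on X_∞ is unique. -/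
open Filter Topology

section Cone

variable {A : Type*} [NormedRing A] [NormedAlgebra ℝ A] {P : Set A}

open scoped Pointwise in
/-- The interior of a cone is stable under positive scaling. -/
theorem IsCone.smul_mem_interior_s5 (hP : IsCone P) {c : A} (hc : c ∈ interior P) {ε : ℝ}
    (hε : 0 < ε) : ε • c ∈ interior P := by
  have hsub : ε • P ⊆ P := by
    rintro _ ⟨x, hx, rfl⟩
    exact hP.smul_mem ε hε.le x hx
  apply interior_mono hsub
  rw [interior_smul₀ hε.ne']
  exact Set.smul_mem_smul_set hc

/-- An element of a cone dominated by all positive multiples of a fixed element vanishes. -/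
theorem IsCone.eq_zero_of_forall_smul_sub_mem (hP : IsCone P) {w z : A} (hw : w ∈ P)
    (h : ∀ ε : ℝ, 0 < ε → ε • z - w ∈ P) : w = 0 := by
  refine hP.antisymm w hw ?_
  have hcont : Continuous fun ε : ℝ => ε • z - w := by fun_prop
  have hlim : Tendsto (fun ε : ℝ => ε • z - w) (𝓝[>] 0) (𝓝 (-w)) := by
    simpa using (hcont.tendsto 0).mono_left nhdsWithin_le_nhds
  exact hP.closed.mem_of_tendsto hlim (eventually_mem_nhdsWithin.mono h)

/-- A c-sequence is eventually dominated by each positive multiple of an interior point. -/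
theorem CSeq.eventually_smul_sub_mem {u : ℕ → A} (hu : CSeq P u) (hP : IsCone P) {c : A}
    (hc : c ∈ interior P) {ε : ℝ} (hε : 0 < ε) : ∀ᶠ n in atTop, ε • c - u n ∈ P := by
  obtain ⟨N, hN⟩ := hu _ (hP.smul_mem_interior_s5 hc hε)
  filter_upwards [eventually_ge_atTop N] with n hn
  exact interior_subset (hN n hn)

end Cone

/-- If each `T n` is `k`-Lipschitz with respect to the cone metric for a common `k ∈ P`,
then the (G)-limit of the family `(T n)` on `X∞` is unique. -/
theorem gLimit_unique {A : Type*} [NormedRing A] [NormedAlgebra ℝ A] [CompleteSpace A]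
    {X : Type*} (P : Set A) (hP : IsCone P) (hsolid : (interior P).Nonempty)
    (d : X → X → A) (hd : IsConeMetric P d)
    (Xn : ℕ → Set X) (hXn : ∀ n, (Xn n).Nonempty) (Xinf : Set X) (hXinf : Xinf.Nonempty)
    (T : ℕ → X → X) (k : A) (hk : k ∈ P)
    (hlip : ∀ n, ∀ x ∈ Xn n, ∀ y ∈ Xn n, k * d x y - d (T n x) (T n y) ∈ P)
    (Tinf Tinf' : X → X)
    (hG : GLimit P d Xn Xinf T Tinf) (hG' : GLimit P d Xn Xinf T Tinf') :
    Set.EqOn Tinf Tinf' Xinf := by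
  obtain ⟨c, hc⟩ := hsolid
  intro x hx
  obtain ⟨u, hu, hux, hTu⟩ := hG x hx
  obtain ⟨v, hv, hvx, hTv⟩ := hG' x hx
  rw [← hd.eq_zero_iff]
  refine hP.eq_zero_of_forall_smul_sub_mem (z := (c + c) + k * (c + c)) (hd.mem_cone _ _) ?_
  intro ε hε
  obtain ⟨n, h₁, h₂, h₃, h₄⟩ := ((hux.eventually_smul_sub_mem hP hc hε).and
    ((hvx.eventually_smul_sub_mem hP hc hε).and
    ((hTu.eventually_smul_sub_mem hP hc hε).and
    (hTv.eventually_smul_sub_mem hP hc hε)))).exists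
  have tri₁ := hd.triangle (Tinf x) (T n (u n)) (Tinf' x)
  have tri₂ := hd.triangle (T n (u n)) (T n (v n)) (Tinf' x)
  have tri₃ := hd.triangle (u n) x (v n)
  rw [hd.symm (Tinf x) (T n (u n))] at tri₁
  rw [hd.symm x (v n)] at tri₃
  have hk₁ := hP.mul_mem k hk _ (hP.add_mem _ (hP.add_mem _ h₁ _ h₂) _ tri₃)
  have hT := hP.add_mem _ (hP.add_mem _ h₃ _ h₄) _ (hP.add_mem _ tri₁ _ tri₂)
  have hsum := hP.add_mem _ (hP.add_mem _ hk₁ _ hT) _ (hlip n _ (hu n) _ (hv n))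
  convert hsum using 1
  simp only [smul_add, mul_add, mul_sub, mul_smul_comm]
  abel
end

section
/- Let D ⊆ ℝ³, let (a, β, γ) ∈ D, and let ā, β̄, γ̄ > 0 be such that the compact set Δ = {(x,y,z) : |x − a| ≤ ā, |y − β| ≤ β̄, |z − γ| ≤ γ̄} is contained in D. Let f_n, g_n, f, g : D → ℝ (n ∈ ℕ) be continuous on D and suppose: (1)–(2) there exist constants k_n, h_n, k, h > 0 with max{k_n, h_n, k, h} ≤ M < 1 for some M ∈ (0,1), such that |f_n(x,y,z) − f_n(x,ȳ,z̄)| ≤ k_n|y − ȳ|, |g_n(x,y,z) − g_n(x,ȳ,z̄)| ≤ h_n|z − z̄|, |f(x,y,z) − f(x,ȳ,z̄)| ≤ k|y − ȳ|, |g(x,y,z) − g(x,ȳ,z̄)| ≤ h|z − z̄| on D; (3) f_n → f and g_n → g pointwise on D; (4) there exist M_f, M_g > 0 with |f_n| ≤ M_f and |g_n| ≤ M_g on Δ for every n. Let h* = min{ā, β̄/M_f, γ̄/M_g}, and for each n let (y_n, z_n) be the unique solution on J = [a − h*, a + h*] of y′ = f_n(x,y,z), z′ = g_n(x,y,z), y(a)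 = β, z(a) = γ with values staying in Δ, and let (y, z) be the unique such solution of y′ = f(x,y,z), z′ = g(x,y,z), y(a) = β, z(a) = γ. Then y_n → y and z_n → z uniformly on J. -/
open Set Filter

/-- Grönwall's inequality to the right of `a`, for a perturbation `e` with small primitive. -/
theorem abs_le_of_deriv_sub_le_right {a b M S : ℝ} (hM : 0 < M) {u u' e : ℝ → ℝ}
    (he : Continuous e) (hu : ∀ x ∈ Icc a b, HasDerivWithinAt u (u' x) (Icc a b) x)
    (hua : u a = 0) (hb : ∀ x ∈ Icc a b, |u' x - e x| ≤ M * |u x|)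
    (hS : ∀ x ∈ Icc a b, |∫ t in a..x, e t| ≤ S) {x : ℝ} (hx : x ∈ Icc a b) :
    |u x| ≤ S * Real.exp (M * (b - a)) := by
  have hE : ∀ t, HasDerivAt (fun s => ∫ r in a..s, e r) (e t) t := fun t =>
    intervalIntegral.integral_hasDerivAt_right (he.intervalIntegrable _ _)
      he.aestronglyMeasurable.stronglyMeasurableAtFilter he.continuousAt
  have hS0 : 0 ≤ S := (abs_nonneg _).trans (hS x hx)
  have hw : ∀ t ∈ Icc a b, HasDerivWithinAt (fun s => u s - ∫ r in a..s, e r)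
      (u' t - e t) (Icc a b) t := fun t ht => (hu t ht).sub (hE t).hasDerivWithinAt
  have key := norm_le_gronwallBound_of_norm_deriv_right_le (δ := 0) (K := M) (ε := M * S)
    (fun t ht => (hw t ht).continuousWithinAt)
    (fun t ht => ((hw t ⟨ht.1, ht.2.le⟩).mono_of_mem_nhdsWithin
      (Icc_mem_nhdsGE_of_mem ht)))
    (by simp [hua])
    (fun t ht => by
      have ht' : t ∈ Icc a b := ⟨ht.1, ht.2.le⟩
      have h1 : |u t| ≤ |u t - ∫ r in a..t, e r| + S := by
        have := abs_add_le (u t - ∫ r in a..t, e r) (∫ r in a..t, e r)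
        rw [sub_add_cancel] at this
        linarith [hS t ht']
      simp only [Real.norm_eq_abs]
      nlinarith [hb t ht'])
    x hx
  rw [gronwallBound_of_K_ne_0 hM.ne', Real.norm_eq_abs, mul_div_cancel_left₀ _ hM.ne'] at key
  have h1 := abs_add_le (u x - ∫ r in a..x, e r) (∫ r in a..x, e r)
  rw [sub_add_cancel] at h1
  have h2 : S * Real.exp (M * (x - a)) ≤ S * Real.exp (M * (b - a)) := by
    gcongr
    exact hx.2
  linarith [hS x hx]

/-- Two-sided version of `abs_le_of_deriv_sub_le_right`. -/
theorem abs_le_of_deriv_sub_le {a r M S : ℝ} (hM : 0 < M) {u u' e : ℝ → ℝ}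
    (he : Continuous e)
    (hu : ∀ x ∈ Icc (a - r) (a + r), HasDerivWithinAt u (u' x) (Icc (a - r) (a + r)) x)
    (hua : u a = 0) (hb : ∀ x ∈ Icc (a - r) (a + r), |u' x - e x| ≤ M * |u x|)
    (hS : ∀ x ∈ Icc (a - r) (a + r), |∫ t in a..x, e t| ≤ S)
    {x : ℝ} (hx : x ∈ Icc (a - r) (a + r)) :
    |u x| ≤ S * Real.exp (M * r) := by
  have hr : 0 ≤ r := by linarith [hx.1, hx.2]
  rcases le_total a x with hax | hxa
  · have hsub : Icc a (a + r) ⊆ Icc (a - r) (a + r) := Icc_subset_Icc_left (by linarith)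
    have := abs_le_of_deriv_sub_le_right hM he (fun t ht => (hu t (hsub ht)).mono hsub) hua
      (fun t ht => hb t (hsub ht)) (fun t ht => hS t (hsub ht)) ⟨hax, hx.2⟩
    rwa [add_sub_cancel_left] at this
  · have hmaps : MapsTo (fun t => 2 * a - t) (Icc a (a + r)) (Icc (a - r) (a + r)) :=
      fun t ht => ⟨by linarith [ht.2], by linarith [ht.1]⟩
    have := abs_le_of_deriv_sub_le_right (a := a) (b := a + r) (M := M) (S := S)
      (u := fun t => u (2 * a - t)) (u' := fun t => -u' (2 * a - t))
      (e := fun t => -e (2 * a - t)) hM (by fun_prop)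
      (fun t ht => by
        have h1 : HasDerivWithinAt (fun t => 2 * a - t) (-1) (Icc a (a + r)) t := by
          simpa using (hasDerivWithinAt_id t _).const_sub (2 * a)
        simpa [Function.comp_def] using (hu _ (hmaps ht)).comp t h1 hmaps)
      (by simpa [two_mul] using hua)
      (fun t ht => by
        have := hb _ (hmaps ht)
        rwa [abs_sub_comm, neg_sub_neg])
      (fun t ht => by
        have := hS _ (hmaps ht)
        rw [intervalIntegral.integral_neg, intervalIntegral.integral_comp_sub_left e,
          abs_neg, intervalIntegral.integral_symm, abs_neg]
        simpa [two_mul] using this)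
      (x := 2 * a - x) ⟨by linarith, by linarith [hx.1]⟩
    simpa using this

/-- Solutions converge uniformly if the derivatives of the differences are controlled by the
differences, up to continuous errors converging to zero boundedly and pointwise. -/
theorem tendstoUniformlyOn_of_deriv_sub_le {a r M C : ℝ} (hr : 0 ≤ r) (hM : 0 < M)
    {v v' e : ℕ → ℝ → ℝ} {w w' : ℝ → ℝ}
    (hv : ∀ n, ∀ x ∈ Icc (a - r) (a + r),
      HasDerivWithinAt (v n) (v' n x) (Icc (a - r) (a + r)) x)
    (hw : ∀ x ∈ Icc (a - r) (a + r), HasDerivWithinAt w (w' x) (Icc (a - r) (a + r)) x)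
    (hva : ∀ n, v n a = w a) (he : ∀ n, ContinuousOn (e n) (Icc (a - r) (a + r)))
    (hb : ∀ n, ∀ x ∈ Icc (a - r) (a + r), |v' n x - w' x - e n x| ≤ M * |v n x - w x|)
    (hC : ∀ n, ∀ x ∈ Icc (a - r) (a + r), |e n x| ≤ C)
    (hlim : ∀ x ∈ Icc (a - r) (a + r), Tendsto (fun n => e n x) atTop (nhds 0)) :
    TendstoUniformlyOn v w atTop (Icc (a - r) (a + r)) := by
  have hle : a - r ≤ a + r := by linarith
  let E : ℕ → ℝ → ℝ := fun n => IccExtend hle ((Icc (a - r) (a + r)).domRestrict (e n))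
  have hEc : ∀ n, Continuous (E n) := fun n => (he n).domRestrict.Icc_extend'
  have hEe : ∀ n, ∀ x ∈ Icc (a - r) (a + r), E n x = e n x := fun n x hx => IccExtend_of_mem hle _ hx
  have hI : Tendsto (fun n => ∫ t in (a - r)..(a + r), |E n t|) atTop (nhds 0) := by
    have := intervalIntegral.tendsto_integral_filter_of_dominated_convergence
      (μ := MeasureTheory.volume) (a := a - r) (b := a + r) (l := atTop)
      (F := fun n t => |E n t|) (f := fun _ => 0) (fun _ => C)
      (.of_forall fun n => (hEc n).abs.aestronglyMeasurable)
      (.of_forall fun n => .of_forall fun t ht => by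
        rw [uIoc_of_le hle] at ht
        simpa [hEe n t (Ioc_subset_Icc_self ht)] using hC n t (Ioc_subset_Icc_self ht))
      intervalIntegrable_const
      (.of_forall fun t ht => by
        rw [uIoc_of_le hle] at ht
        simpa [hEe _ t (Ioc_subset_Icc_self ht)] using (hlim t (Ioc_subset_Icc_self ht)).abs)
    simpa using this
  have hbound : ∀ n, ∀ x ∈ Icc (a - r) (a + r),
      |v n x - w x| ≤ (∫ t in (a - r)..(a + r), |E n t|) * Real.exp (M * r) := fun n x hx =>
    abs_le_of_deriv_sub_le (u := fun t => v n t - w t) (u' := fun t => v' n t - w' t) hM (hEc n)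
      (fun t ht => (hv n t ht).sub (hw t ht)) (by simp [hva])
      (fun t ht => by simpa only [hEe n t ht] using hb n t ht)
      (fun t ht => by
        refine (intervalIntegral.norm_integral_le_integral_norm_uIoc (f := E n)).trans ?_
        rw [intervalIntegral.integral_of_le hle]
        refine MeasureTheory.setIntegral_mono_set ?_ (.of_forall fun _ => abs_nonneg _) ?_
        · exact ((hEc n).abs.intervalIntegrable _ _).1
        · refine LE.le.eventuallyLE (Ioc_subset_Ioc ?_ ?_)
          · exact le_min (by linarith) ht.1
          · exact max_le (by linarith) ht.2) hx
  have hlim' := hI.mul_const (Real.exp (M * r))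
  rw [zero_mul] at hlim'
  rw [Metric.tendstoUniformlyOn_iff]
  intro ε hε
  filter_upwards [hlim'.eventually (gt_mem_nhds hε)] with n hn x hx
  rw [dist_comm, Real.dist_eq]
  exact (hbound n x hx).trans_lt hn

/-- If the right-hand sides `f n, g n` of a family of nonlinear differential systems converge
pointwise on `D` to `f, g`, all with Lipschitz constants uniformly bounded by `M < 1` and
uniformly bounded by `M_f, M_g` on `Δ`, then the unique solutions `(y n, z n)` of the
approximating systems converge uniformly on `J = [a - h*, a + h*]` to the unique solution
`(y, z)` of the limit system. -/
theorem solutions_converge_uniformly_system_ODE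
    (D : Set (ℝ × ℝ × ℝ)) (a β γ abar βbar γbar : ℝ)
    (hmem : (a, β, γ) ∈ D) (habar : 0 < abar) (hβbar : 0 < βbar) (hγbar : 0 < γbar)
    (hΔD : ∀ x y z : ℝ, |x - a| ≤ abar → |y - β| ≤ βbar → |z - γ| ≤ γbar → (x, y, z) ∈ D)
    (fn gn : ℕ → ℝ → ℝ → ℝ → ℝ) (f g : ℝ → ℝ → ℝ → ℝ)
    (hfnc : ∀ n, ContinuousOn (fun p : ℝ × ℝ × ℝ => fn n p.1 p.2.1 p.2.2) D)
    (hgnc : ∀ n, ContinuousOn (fun p : ℝ × ℝ × ℝ => gn n p.1 p.2.1 p.2.2) D)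
    (hfc : ContinuousOn (fun p : ℝ × ℝ × ℝ => f p.1 p.2.1 p.2.2) D)
    (hgc : ContinuousOn (fun p : ℝ × ℝ × ℝ => g p.1 p.2.1 p.2.2) D)
    (M : ℝ) (hM0 : 0 < M) (hM1 : M < 1)
    (kn hn : ℕ → ℝ) (k h : ℝ)
    (hkn0 : ∀ n, 0 < kn n) (hhn0 : ∀ n, 0 < hn n) (hk0 : 0 < k) (hh0 : 0 < h)
    (hknM : ∀ n, kn n ≤ M) (hhnM : ∀ n, hn n ≤ M) (hkM : k ≤ M) (hhM : h ≤ M)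
    (hfnL : ∀ (n : ℕ) (x y z ybar zbar : ℝ), (x, y, z) ∈ D → (x, ybar, zbar) ∈ D →
      |fn n x y z - fn n x ybar zbar| ≤ kn n * |y - ybar|)
    (hgnL : ∀ (n : ℕ) (x y z ybar zbar : ℝ), (x, y, z) ∈ D → (x, ybar, zbar) ∈ D →
      |gn n x y z - gn n x ybar zbar| ≤ hn n * |z - zbar|)
    (hfL : ∀ x y z ybar zbar : ℝ, (x, y, z) ∈ D → (x, ybar, zbar) ∈ D →
      |f x y z - f x ybar zbar| ≤ k * |y - ybar|)
    (hgL : ∀ x y z ybar zbar : ℝ, (x, y, z) ∈ D → (x, ybar, zbar) ∈ D →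
      |g x y z - g x ybar zbar| ≤ h * |z - zbar|)
    (hfp : ∀ x y z : ℝ, (x, y, z) ∈ D →
      Tendsto (fun n => fn n x y z) atTop (nhds (f x y z)))
    (hgp : ∀ x y z : ℝ, (x, y, z) ∈ D →
      Tendsto (fun n => gn n x y z) atTop (nhds (g x y z)))
    (Mf Mg : ℝ) (hMf : 0 < Mf) (hMg : 0 < Mg)
    (hfnb : ∀ (n : ℕ) (x y z : ℝ), |x - a| ≤ abar → |y - β| ≤ βbar → |z - γ| ≤ γbar →
      |fn n x y z| ≤ Mf)
    (hgnb : ∀ (n : ℕ) (x y z : ℝ), |x - a| ≤ abar → |y - β| ≤ βbar → |z - γ| ≤ γbar →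
      |gn n x y z| ≤ Mg)
    (hstar : ℝ) (hhstar : hstar = min abar (min (βbar / Mf) (γbar / Mg)))
    (yn zn : ℕ → ℝ → ℝ) (y z : ℝ → ℝ)
    (hsoln : ∀ n : ℕ, yn n a = β ∧ zn n a = γ ∧
      ∀ x ∈ Icc (a - hstar) (a + hstar),
        HasDerivWithinAt (yn n) (fn n x (yn n x) (zn n x)) (Icc (a - hstar) (a + hstar)) x ∧
        HasDerivWithinAt (zn n) (gn n x (yn n x) (zn n x)) (Icc (a - hstar) (a + hstar)) x ∧
        |yn n x - β| ≤ βbar ∧ |zn n x - γ| ≤ γbar)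
    (hsol : y a = β ∧ z a = γ ∧
      ∀ x ∈ Icc (a - hstar) (a + hstar),
        HasDerivWithinAt y (f x (y x) (z x)) (Icc (a - hstar) (a + hstar)) x ∧
        HasDerivWithinAt z (g x (y x) (z x)) (Icc (a - hstar) (a + hstar)) x ∧
        |y x - β| ≤ βbar ∧ |z x - γ| ≤ γbar) :
    TendstoUniformlyOn (fun n => yn n) y atTop (Icc (a - hstar) (a + hstar)) ∧
    TendstoUniformlyOn (fun n => zn n) z atTop (Icc (a - hstar) (a + hstar)) := by
  have hr : 0 ≤ hstar := by rw [hhstar]; positivity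
  have hra : hstar ≤ abar := by rw [hhstar]; exact min_le_left _ _
  have hxa : ∀ x ∈ Icc (a - hstar) (a + hstar), |x - a| ≤ abar := fun x hx =>
    abs_le.2 ⟨by linarith [hx.1], by linarith [hx.2]⟩
  obtain ⟨hya, hza, hs⟩ := hsol
  have hD : ∀ x ∈ Icc (a - hstar) (a + hstar), (x, y x, z x) ∈ D := fun x hx =>
    hΔD _ _ _ (hxa x hx) (hs x hx).2.2.1 (hs x hx).2.2.2
  have hDn : ∀ n, ∀ x ∈ Icc (a - hstar) (a + hstar), (x, yn n x, zn n x) ∈ D := fun n x hx =>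
    hΔD _ _ _ (hxa x hx) ((hsoln n).2.2 x hx).2.2.1 ((hsoln n).2.2 x hx).2.2.2
  have hcurve : ContinuousOn (fun x => (x, y x, z x)) (Icc (a - hstar) (a + hstar)) :=
    fun x hx => continuousWithinAt_id.prodMk
      ((hs x hx).1.continuousWithinAt.prodMk (hs x hx).2.1.continuousWithinAt)
  have hfb : ∀ x ∈ Icc (a - hstar) (a + hstar), |f x (y x) (z x)| ≤ Mf := fun x hx =>
    le_of_tendsto (hfp _ _ _ (hD x hx)).abs <| .of_forall fun n =>
      hfnb n _ _ _ (hxa x hx) (hs x hx).2.2.1 (hs x hx).2.2.2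
  have hgb : ∀ x ∈ Icc (a - hstar) (a + hstar), |g x (y x) (z x)| ≤ Mg := fun x hx =>
    le_of_tendsto (hgp _ _ _ (hD x hx)).abs <| .of_forall fun n =>
      hgnb n _ _ _ (hxa x hx) (hs x hx).2.2.1 (hs x hx).2.2.2
  constructor
  · refine tendstoUniformlyOn_of_deriv_sub_le (C := Mf + Mf)
      (e := fun n x => fn n x (y x) (z x) - f x (y x) (z x)) hr hM0
      (fun n x hx => ((hsoln n).2.2 x hx).1) (fun x hx => (hs x hx).1)
      (fun n => (hsoln n).1.trans hya.symm)
      (fun n => ((hfnc n).comp hcurve hD).sub (hfc.comp hcurve hD)) ?_ ?_ ?_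
    · intro n x hx
      rw [sub_sub_sub_cancel_right]
      exact (hfnL n _ _ _ _ _ (hDn n x hx) (hD x hx)).trans
        (mul_le_mul_of_nonneg_right (hknM n) (abs_nonneg _))
    · exact fun n x hx => (abs_sub _ _).trans
        (add_le_add (hfnb n _ _ _ (hxa x hx) (hs x hx).2.2.1 (hs x hx).2.2.2) (hfb x hx))
    · exact fun x hx => tendsto_sub_nhds_zero_iff.2 (hfp _ _ _ (hD x hx))
  · refine tendstoUniformlyOn_of_deriv_sub_le (C := Mg + Mg)
      (e := fun n x => gn n x (y x) (z x) - g x (y x) (z x)) hr hM0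
      (fun n x hx => ((hsoln n).2.2 x hx).2.1) (fun x hx => (hs x hx).2.1)
      (fun n => (hsoln n).2.1.trans hza.symm)
      (fun n => ((hgnc n).comp hcurve hD).sub (hgc.comp hcurve hD)) ?_ ?_ ?_
    · intro n x hx
      rw [sub_sub_sub_cancel_right]
      exact (hgnL n _ _ _ _ _ (hDn n x hx) (hD x hx)).trans
        (mul_le_mul_of_nonneg_right (hhnM n) (abs_nonneg _))
    · exact fun n x hx => (abs_sub _ _).trans
        (add_le_add (hgnb n _ _ _ (hxa x hx) (hs x hx).2.2.1 (hs x hx).2.2.2) (hgb x hx))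
    · exact fun x hx => tendsto_sub_nhds_zero_iff.2 (hgp _ _ _ (hD x hx))
end
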